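/- Let G be an abelian group, φ : G → G a group endomorphism, and k a positive integer. Then the intrinsic algebraic entropy satisfies the Logarithmic Law: ent̃(φ^k) = k · ent̃(φ) (as an equality in [0,∞]). -/

import Mathlib

open Filter Topology ENNReal

variable {G : Type*}

/-- The `n`-th partial `φ`-trajectory of a subgroup `H`:
`T_n(φ,H) = H + φ(H) + ... + φ^{n-1}(H)`. -/
noncomputable def traj [AddCommGroup G] (φ : AddMonoid.End G) (H : AddSubgroup G) (n : ℕ) :
    AddSubgroup G :=
  ⨆ i ∈ Finset.range n, H.map (φ ^ i)

/-- `H` is `φ`-inert if `(H + φ(H))/H` is finite. -/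
def IsInert [AddCommGroup G] (φ : AddMonoid.End G) (H : AddSubgroup G) : Prop :=
  Finite (↥(H ⊔ H.map φ) ⧸ H.addSubgroupOf (H ⊔ H.map φ))

/-- The sequence `n ↦ log |T_n(φ,H)/H| / n`. -/
noncomputable def entFun [AddCommGroup G] (φ : AddMonoid.End G) (H : AddSubgroup G) (n : ℕ) : ℝ :=
  Real.log (Nat.card (↥(traj φ H n) ⧸ H.addSubgroupOf (traj φ H n))) / n

/-- The intrinsic entropy of `φ` with respect to `H`: the limit of `entFun φ H`. -/
noncomputable def entWrt [AddCommGroup G] (φ : AddMonoid.End G) (H : AddSubgroup G) : ℝ :=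
  limUnder atTop (entFun φ H)

/-- The intrinsic algebraic entropy of `φ`. -/
noncomputable def intrinsicEnt [AddCommGroup G] (φ : AddMonoid.End G) : ℝ≥0∞ :=
  ⨆ (H : AddSubgroup G) (_ : IsInert φ H), ENNReal.ofReal (entWrt φ H)

/-- The `φ`-trajectory of `H`: `T(φ,H) = ⋃_{n ≥ 1} T_n(φ,H)`. -/
noncomputable def trajAll [AddCommGroup G] (φ : AddMonoid.End G) (H : AddSubgroup G) :
    AddSubgroup G :=
  ⨆ n : ℕ, traj φ H (n + 1)

section RelIndex

variable [AddCommGroup G]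

theorem AddSubgroup.relIndex_map_map_dvd {G' : Type*} [AddCommGroup G'] (f : G →+ G')
    (A B : AddSubgroup G) : (A.map f).relIndex (B.map f) ∣ A.relIndex B := by
  rw [← AddSubgroup.relIndex_comap]
  exact AddSubgroup.relIndex_dvd_of_le_left _ (AddSubgroup.le_comap_map f A)

theorem AddSubgroup.FG.mono {A B : AddSubgroup G} (hB : B.FG) (h : A ≤ B) : A.FG := by
  rw [← AddSubgroup.toIntSubmodule_toAddSubgroup A, ← Submodule.fg_iff_addSubgroup_fg]
  rw [← AddSubgroup.toIntSubmodule_toAddSubgroup B, ← Submodule.fg_iff_addSubgroup_fg] at hB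
  exact hB.of_le h

theorem AddSubgroup.relIndex_ne_zero_of_fg {A B : AddSubgroup G} (hB : B.FG)
    (h : ∀ b ∈ B, ∃ n : ℕ, 0 < n ∧ n • b ∈ A) : A.relIndex B ≠ 0 := by
  have : AddGroup.FG B := (AddGroup.fg_iff_addSubgroup_fg B).2 hB
  have : Finite (B ⧸ A.addSubgroupOf B) := by
    refine AddCommGroup.finite_of_fg_isAddTorsion _ ?_
    rintro ⟨b⟩
    obtain ⟨n, hn, hb⟩ := h b b.2
    refine isOfFinAddOrder_iff_nsmul_eq_zero.2 ⟨n, hn, ?_⟩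
    exact (QuotientAddGroup.eq_zero_iff (n • b)).2 (by simpa [AddSubgroup.mem_addSubgroupOf])
  exact Nat.card_pos.ne'

theorem AddSubgroup.exists_fg_le_sup {A B : AddSubgroup G} (h : A.relIndex B ≠ 0) :
    ∃ F : AddSubgroup G, F.FG ∧ F ≤ B ∧ B ≤ A ⊔ F := by
  have : Finite (B ⧸ A.addSubgroupOf B) := Nat.finite_of_card_ne_zero h
  let r : B ⧸ A.addSubgroupOf B → G := fun q => (q.out : B)
  refine ⟨AddSubgroup.closure (Set.range r),
    (AddSubgroup.fg_iff _).2 ⟨_, rfl, Set.finite_range r⟩, ?_, fun b hb => ?_⟩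
  · rw [AddSubgroup.closure_le]
    rintro _ ⟨q, rfl⟩
    exact q.out.2
  · have h1 : -((QuotientAddGroup.mk ⟨b, hb⟩ : B ⧸ A.addSubgroupOf B).out) + ⟨b, hb⟩
        ∈ A.addSubgroupOf B := QuotientAddGroup.eq.1 (QuotientAddGroup.out_eq' _)
    rw [AddSubgroup.mem_addSubgroupOf] at h1
    have h2 : r (QuotientAddGroup.mk ⟨b, hb⟩) ∈ AddSubgroup.closure (Set.range r) :=
      AddSubgroup.subset_closure ⟨_, rfl⟩
    have h3 := AddSubgroup.add_mem_sup h1 h2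
    simpa [r] using h3

end RelIndex

section Traj

variable [AddCommGroup G] {φ : AddMonoid.End G} {H : AddSubgroup G}

theorem isInert_iff : IsInert φ H ↔ H.relIndex (H.map φ) ≠ 0 := by
  rw [← AddSubgroup.relIndex_sup_left (H := H.map φ) (K := H)]
  exact ⟨fun h => (@Nat.card_pos _ _ h).ne', fun h => Nat.finite_of_card_ne_zero h⟩

theorem traj_mono_right (φ : AddMonoid.End G) (H : AddSubgroup G) : Monotone (traj φ H) :=
  fun _ _ h => biSup_mono fun _ hi => Finset.range_mono h hi

theorem traj_mono_left (φ : AddMonoid.End G) {A B : AddSubgroup G} (h : A ≤ B) (n : ℕ) :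
    traj φ A n ≤ traj φ B n :=
  iSup₂_mono fun _ _ => AddSubgroup.map_mono h

theorem traj_zero (φ : AddMonoid.End G) (H : AddSubgroup G) : traj φ H 0 = ⊥ := by
  simp [traj]

theorem traj_one (φ : AddMonoid.End G) (H : AddSubgroup G) : traj φ H 1 = H := by
  simp only [traj, Finset.range_one, Finset.mem_singleton, iSup_iSup_eq_left, pow_zero]
  exact AddSubgroup.map_id H

theorem le_traj (φ : AddMonoid.End G) (H : AddSubgroup G) {n : ℕ} (hn : 0 < n) :
    H ≤ traj φ H n :=
  (traj_one φ H).symm.le.trans (traj_mono_right φ H hn)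

theorem traj_add (φ : AddMonoid.End G) (H : AddSubgroup G) (m n : ℕ) :
    traj φ H (m + n) = traj φ H m ⊔ (traj φ H n).map (φ ^ m) := by
  have hmap (i : ℕ) : (H.map (φ ^ i)).map (φ ^ m) = H.map (φ ^ (m + i)) := by
    rw [pow_add]
    exact AddSubgroup.map_map H _ _
  have h : (traj φ H n).map (φ ^ m) = ⨆ i ∈ Finset.range n, H.map (φ ^ (m + i)) := by
    simp only [← hmap]
    exact (AddSubgroup.gc_map_comap _).l_iSup₂
  rw [h]
  simp only [traj, Finset.mem_range]
  refine le_antisymm (iSup₂_le fun i hi => ?_) (sup_le (iSup₂_le fun i hi => ?_)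
    (iSup₂_le fun i hi => ?_))
  · rcases lt_or_ge i m with him | him
    · exact le_sup_of_le_left (le_iSup₂_of_le i him le_rfl)
    · obtain ⟨j, rfl⟩ := Nat.exists_eq_add_of_le him
      exact le_sup_of_le_right (le_iSup₂_of_le j (by omega) le_rfl)
  · exact le_iSup₂_of_le i (by omega) le_rfl
  · exact le_iSup₂_of_le (m + i) (by omega) le_rfl

theorem traj_succ (φ : AddMonoid.End G) (H : AddSubgroup G) (n : ℕ) :
    traj φ H (n + 1) = H ⊔ (traj φ H n).map φ := by
  rw [add_comm, traj_add, traj_one, pow_one]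

theorem map_pow_traj_le (φ : AddMonoid.End G) (H : AddSubgroup G) (m n : ℕ) :
    (traj φ H n).map (φ ^ m) ≤ traj φ H (m + n) :=
  le_sup_right.trans (traj_add φ H m n).symm.le

theorem traj_pow (φ : AddMonoid.End G) (H : AddSubgroup G) (k n : ℕ) :
    traj (φ ^ k) (traj φ H k) n = traj φ H (k * n) := by
  induction n with
  | zero => simp [traj_zero]
  | succ n ih => rw [traj_succ, ih, mul_add_one, add_comm, traj_add]

theorem traj_pow_le (φ : AddMonoid.End G) (H : AddSubgroup G) {k : ℕ} (hk : 0 < k) (n : ℕ) :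
    traj (φ ^ k) H n ≤ traj φ H (k * n) :=
  (traj_mono_left _ (le_traj φ H hk) n).trans (traj_pow φ H k n).le

theorem IsInert.relIndex_traj_ne_zero (h : IsInert φ H) (n : ℕ) :
    H.relIndex (traj φ H n) ≠ 0 := by
  induction n with
  | zero => simp [traj_zero]
  | succ n ih =>
    rw [traj_succ, AddSubgroup.relIndex_sup_left]
    exact AddSubgroup.relIndex_ne_zero_trans (isInert_iff.1 h)
      (ne_zero_of_dvd_ne_zero ih (AddSubgroup.relIndex_map_map_dvd _ _ _))

theorem IsInert.one_le_relIndex_traj (h : IsInert φ H) (n : ℕ) :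
    (1 : ℝ) ≤ H.relIndex (traj φ H n) :=
  Nat.one_le_cast.2 (Nat.one_le_iff_ne_zero.2 (h.relIndex_traj_ne_zero n))

theorem IsInert.relIndex_traj_add_le (h : IsInert φ H) (m n : ℕ) :
    H.relIndex (traj φ H (m + n + 1)) ≤
      H.relIndex (traj φ H (m + 1)) * H.relIndex (traj φ H (n + 1)) := by
  have hsup : traj φ H (m + n + 1) = traj φ H (m + 1) ⊔ (traj φ H (n + 1)).map (φ ^ m) := by
    refine le_antisymm ?_ (sup_le (traj_mono_right φ H (by omega)) (map_pow_traj_le φ H m (n + 1)))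
    rw [add_assoc, traj_add]
    exact sup_le_sup_right (traj_mono_right φ H (by omega)) _
  rw [← AddSubgroup.relIndex_mul_relIndex H _ _ (le_traj φ H m.succ_pos)
    (traj_mono_right φ H (show m + 1 ≤ m + n + 1 by omega)), hsup,
    AddSubgroup.relIndex_sup_left]
  refine Nat.mul_le_mul_left _ ?_
  have hd := AddSubgroup.relIndex_map_map_dvd (φ ^ m) H (traj φ H (n + 1))
  have hne := h.relIndex_traj_ne_zero (n + 1)
  have hle : H.map (φ ^ m) ≤ traj φ H (m + 1) := by
    simpa only [traj_one] using map_pow_traj_le φ H m 1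
  exact (AddSubgroup.relIndex_le_of_le_left hle (ne_zero_of_dvd_ne_zero hne hd)).trans
    (Nat.le_of_dvd (Nat.pos_of_ne_zero hne) hd)

theorem entFun_eq (φ : AddMonoid.End G) (H : AddSubgroup G) (n : ℕ) :
    entFun φ H n = Real.log (H.relIndex (traj φ H n)) / n := rfl

theorem IsInert.tendsto_entFun (h : IsInert φ H) :
    Tendsto (entFun φ H) atTop (𝓝 (entWrt φ H)) := by
  refine tendsto_nhds_limUnder ?_
  let u : ℕ → ℝ := fun n => Real.log (H.relIndex (traj φ H (n + 1)))
  have hu : Subadditive u := fun m n => by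
    have hpos (i : ℕ) : (H.relIndex (traj φ H i) : ℝ) ≠ 0 :=
      (zero_lt_one.trans_le (h.one_le_relIndex_traj i)).ne'
    simp only [u]
    rw [← Real.log_mul (hpos _) (hpos _)]
    exact Real.log_le_log (zero_lt_one.trans_le (h.one_le_relIndex_traj _))
      (mod_cast h.relIndex_traj_add_le m n)
  have hbdd : BddBelow (Set.range fun n => u n / n) := by
    refine ⟨0, ?_⟩
    rintro _ ⟨n, rfl⟩
    exact div_nonneg (Real.log_nonneg (h.one_le_relIndex_traj _)) n.cast_nonneg
  refine ⟨hu.lim, (tendsto_add_atTop_iff_nat 1).1 ?_⟩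
  have hlim := (hu.tendsto_lim hbdd).mul (tendsto_natCast_div_add_atTop (1 : ℝ))
  rw [mul_one] at hlim
  refine hlim.congr' ((eventually_gt_atTop 0).mono fun n hn => ?_)
  have : (n : ℝ) ≠ 0 := by positivity
  simp only [entFun_eq, u]
  push_cast
  field_simp

theorem IsInert.le_intrinsicEnt (h : IsInert φ H) :
    ENNReal.ofReal (entWrt φ H) ≤ intrinsicEnt φ :=
  le_iSup₂_of_le H h le_rfl

theorem IsInert.traj_pow (h : IsInert φ H) (k : ℕ) : IsInert (φ ^ k) (traj φ H k) := by
  rcases Nat.eq_zero_or_pos k with rfl | hk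
  · rw [isInert_iff, traj_zero]
    exact (AddSubgroup.relIndex_eq_one.2 (AddSubgroup.map_bot _).le).trans_ne one_ne_zero
  rw [isInert_iff]
  have hne := h.relIndex_traj_ne_zero (k + k)
  rw [← AddSubgroup.relIndex_mul_relIndex H (traj φ H k) _ (le_traj φ H hk)
    (traj_mono_right φ H (by omega)), traj_add, AddSubgroup.relIndex_sup_left] at hne
  exact right_ne_zero_of_mul hne

theorem tendsto_entFun_mul {k : ℕ} (hk : 0 < k) (h : IsInert φ H) :
    Tendsto (fun n => k * entFun φ H (k * n)) atTop (𝓝 (k * entWrt φ H)) :=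
  (h.tendsto_entFun.comp (tendsto_id.const_mul_atTop' hk)).const_mul _

theorem IsInert.entWrt_pow_traj {k : ℕ} (hk : 0 < k) (h : IsInert φ H) :
    entWrt (φ ^ k) (traj φ H k) = k * entWrt φ H := by
  have h1 := (h.traj_pow k).tendsto_entFun.add
    ((tendsto_const_nhds (x := Real.log (H.relIndex (traj φ H k)))).div_atTop
      tendsto_natCast_atTop_atTop)
  rw [add_zero] at h1
  refine tendsto_nhds_unique h1 ((tendsto_entFun_mul hk h).congr'
    ((eventually_gt_atTop 0).mono fun n hn => ?_))
  have hn' : (n : ℝ) ≠ 0 := by positivity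
  have hk' : (k : ℝ) ≠ 0 := by positivity
  have hne := h.relIndex_traj_ne_zero (k * n)
  have hmul := AddSubgroup.relIndex_mul_relIndex H (traj φ H k) _ (le_traj φ H hk)
    (traj_mono_right φ H (Nat.le_mul_of_pos_right k hn))
  rw [← hmul] at hne
  beta_reduce
  rw [entFun_eq, entFun_eq, _root_.traj_pow, ← hmul, Nat.cast_mul,
    Real.log_mul (mod_cast left_ne_zero_of_mul hne) (mod_cast right_ne_zero_of_mul hne)]
  push_cast
  field_simp
  ring

theorem mul_intrinsicEnt_le (φ : AddMonoid.End G) {k : ℕ} (hk : 0 < k) :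
    (k : ℝ≥0∞) * intrinsicEnt φ ≤ intrinsicEnt (φ ^ k) := by
  simp only [intrinsicEnt, ENNReal.mul_iSup]
  refine iSup₂_le fun H h => le_trans ?_ (h.traj_pow k).le_intrinsicEnt
  rw [h.entWrt_pow_traj hk, ENNReal.ofReal_mul k.cast_nonneg, ENNReal.ofReal_natCast]

end Traj

section Algebraic

open Polynomial

variable [AddCommGroup G] {φ : AddMonoid.End G} {H : AddSubgroup G}

theorem IsInert.sup {A B : AddSubgroup G} (hA : IsInert φ A) (hB : IsInert φ B) :
    IsInert φ (A ⊔ B) := by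
  rw [isInert_iff] at *
  have hmap : (A ⊔ B).map φ = A.map φ ⊔ B.map φ := AddSubgroup.map_sup A B φ
  have h (C : AddSubgroup G) (hC : C ≤ A ⊔ B) (hi : C.relIndex (C.map φ) ≠ 0) :
      (A ⊔ B).relIndex (C.map φ) ≠ 0 :=
    ne_zero_of_dvd_ne_zero hi (AddSubgroup.relIndex_dvd_of_le_left _ hC)
  have hA' := h A le_sup_left hA
  have hB' := h B le_sup_right hB
  rw [← AddSubgroup.relIndex_sup_left, hmap, ← sup_assoc]
  refine AddSubgroup.relIndex_ne_zero_trans (K := A ⊔ B ⊔ A.map φ) ?_ ?_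
  · rwa [AddSubgroup.relIndex_sup_left]
  · rw [AddSubgroup.relIndex_sup_left]
    exact ne_zero_of_dvd_ne_zero hB' (AddSubgroup.relIndex_dvd_of_le_left _ le_sup_left)

theorem exists_fg_isInert_mem {x : G} {p : ℤ[X]} (hp : p ≠ 0) (hx : aeval φ p x = 0) :
    ∃ F : AddSubgroup G, F.FG ∧ IsInert φ F ∧ x ∈ F := by
  set d := p.natDegree
  set s : Set G := (fun i => (φ ^ i) x) '' Set.Iic d
  have hs : s.Finite := (Set.finite_Iic d).image _
  have hmem (i : ℕ) (hi : i ≤ d) : (φ ^ i) x ∈ AddSubgroup.closure s :=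
    AddSubgroup.subset_closure ⟨i, hi, rfl⟩
  have hmap : (AddSubgroup.closure s).map φ = AddSubgroup.closure (φ '' s) :=
    AddMonoidHom.map_closure φ s
  have hfg : (AddSubgroup.closure s).FG := (AddSubgroup.fg_iff _).2 ⟨s, rfl, hs⟩
  have hlead : p.leadingCoeff • (φ ^ (d + 1)) x ∈ AddSubgroup.closure s := by
    have h0 : aeval φ (X * p) x = 0 := by
      rw [map_mul, aeval_X, AddMonoid.End.coe_mul, Function.comp_apply, hx, map_zero]
    have hsum : aeval φ (X * p) x = ∑ i ∈ Finset.range (d + 1), p.coeff i • (φ ^ (i + 1)) x := by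
      rw [map_mul, aeval_X, aeval_eq_sum_range, Finset.mul_sum]
      simp only [mul_smul_comm, ← pow_succ']
      exact (map_sum (AddMonoidHom.eval x) _ _)
    rw [h0, Finset.sum_range_succ] at hsum
    rw [show p.leadingCoeff = p.coeff d from rfl, eq_neg_of_add_eq_zero_right hsum.symm]
    exact neg_mem (sum_mem fun i hi => zsmul_mem (hmem _ (Finset.mem_range.1 hi)) _)
  refine ⟨AddSubgroup.closure s, hfg, ?_, hmem 0 d.zero_le⟩
  rw [isInert_iff, hmap]
  refine AddSubgroup.relIndex_ne_zero_of_fg ((AddSubgroup.fg_iff _).2 ⟨_, rfl, hs.image _⟩)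
    fun b hb => ⟨p.leadingCoeff.natAbs, by simpa [Int.natAbs_pos] using hp, ?_⟩
  have hle : AddSubgroup.closure (φ '' s) ≤
      (AddSubgroup.closure s).comap (zsmulAddGroupHom p.leadingCoeff) := by
    rw [AddSubgroup.closure_le]
    rintro _ ⟨_, ⟨i, hi, rfl⟩, rfl⟩
    have hi' : φ ((φ ^ i) x) = (φ ^ (i + 1)) x := by
      rw [pow_succ', AddMonoid.End.coe_mul, Function.comp_apply]
    simp only [hi', SetLike.mem_coe, AddSubgroup.mem_comap, zsmulAddGroupHom_apply]
    rcases (Set.mem_Iic.1 hi).eq_or_lt with rfl | hlt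
    · exact hlead
    · exact zsmul_mem (hmem _ hlt) _
  have := hle hb
  rw [AddSubgroup.mem_comap, zsmulAddGroupHom_apply] at this
  rcases Int.natAbs_eq p.leadingCoeff with h | h
  · rwa [h, natCast_zsmul] at this
  · rw [h, neg_zsmul, natCast_zsmul] at this
    exact neg_mem_iff.1 this

theorem exists_fg_isInert_ge (hφ : ∀ x : G, ∃ p : ℤ[X], p ≠ 0 ∧ aeval φ p x = 0)
    {F : AddSubgroup G} (hF : F.FG) : ∃ E : AddSubgroup G, E.FG ∧ IsInert φ E ∧ F ≤ E := by
  classical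
  obtain ⟨s, rfl⟩ := hF
  simp only [AddSubgroup.closure_le]
  induction s using Finset.induction_on with
  | empty =>
    refine ⟨⊥, ⟨∅, by simp⟩, ?_, by simp⟩
    rw [isInert_iff]
    exact (AddSubgroup.relIndex_eq_one.2 (AddSubgroup.map_bot _).le).trans_ne one_ne_zero
  | insert x s _ ih =>
    obtain ⟨E, hE, hEi, hsE⟩ := ih
    obtain ⟨p, hp, hx⟩ := hφ x
    obtain ⟨E', hE', hEi', hxE'⟩ := exists_fg_isInert_mem hp hx
    refine ⟨E' ⊔ E, hE'.sup hE, hEi'.sup hEi, ?_⟩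
    rw [Finset.coe_insert, Set.insert_subset_iff]
    exact ⟨(le_sup_left : E' ≤ E' ⊔ E) hxE', hsE.trans (le_sup_right : E ≤ E' ⊔ E)⟩

theorem traj_succ_le_sup {F : AddSubgroup G} (h : H.map φ ≤ H ⊔ F) (n : ℕ) :
    traj φ H (n + 1) ≤ H ⊔ traj φ F n := by
  induction n with
  | zero => rw [traj_one]; exact le_sup_left
  | succ n ih =>
    rw [traj_succ φ H, traj_succ φ F]
    have hmap : (H ⊔ traj φ F n).map φ = H.map φ ⊔ (traj φ F n).map φ :=
      AddSubgroup.map_sup _ _ _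
    refine sup_le le_sup_left ((AddSubgroup.map_mono ih).trans (hmap.le.trans ?_))
    rw [← sup_assoc]
    exact sup_le_sup_right h _

theorem traj_le_traj_succ {F : AddSubgroup G} (h : F ≤ H ⊔ H.map φ) (n : ℕ) :
    traj φ F n ≤ traj φ H (n + 1) := by
  induction n with
  | zero => rw [traj_zero]; exact bot_le
  | succ n ih =>
    rw [traj_succ φ F, traj_succ φ H]
    refine sup_le (h.trans (sup_le_sup_left (AddSubgroup.map_mono (le_traj φ H n.succ_pos)) _))
      ((AddSubgroup.map_mono ih).trans le_sup_right)

theorem exists_entWrt_pow_le (hφ : ∀ x : G, ∃ p : ℤ[X], p ≠ 0 ∧ aeval φ p x = 0) {k : ℕ}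
    (hk : 0 < k) (h : IsInert (φ ^ k) H) :
    ∃ E : AddSubgroup G, IsInert φ E ∧ entWrt (φ ^ k) H ≤ k * entWrt φ E := by
  obtain ⟨F, hF, hFle, hleF⟩ := AddSubgroup.exists_fg_le_sup (isInert_iff.1 h)
  obtain ⟨E, hE, hEi, hFE⟩ := exists_fg_isInert_ge hφ hF
  refine ⟨E, hEi, ?_⟩
  let U : AddSubgroup G :=
    (AddCommGroup.torsion (G ⧸ H)).comap (QuotientAddGroup.mk' H)
  have hU {g : G} : g ∈ U ↔ ∃ n : ℕ, 0 < n ∧ n • g ∈ H := by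
    refine isOfFinAddOrder_iff_nsmul_eq_zero.trans
      (exists_congr fun n => and_congr_right fun _ => ?_)
    exact QuotientAddGroup.eq_zero_iff (n • g)
  have hC : H.relIndex (E ⊓ U) ≠ 0 :=
    AddSubgroup.relIndex_ne_zero_of_fg (hE.mono inf_le_left) fun b hb => hU.1 hb.2
  have hTU (n : ℕ) : traj (φ ^ k) F n ≤ U := fun g hg => by
    obtain ⟨m, hm, -, hmem⟩ := AddSubgroup.exists_nsmul_mem_of_relIndex_ne_zero
      (h.relIndex_traj_ne_zero (n + 1)) (traj_le_traj_succ (hFle.trans le_sup_right) n hg)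
    exact hU.2 ⟨m, hm, hmem.1⟩
  have hTE (n : ℕ) : traj (φ ^ k) F n ≤ traj φ E (k * (n + 1)) :=
    ((traj_mono_left _ hFE n).trans (traj_pow_le φ E hk n)).trans
      (traj_mono_right φ E (Nat.mul_le_mul_left k n.le_succ))
  have hle (n : ℕ) : H.relIndex (traj (φ ^ k) H (n + 1)) ≤
      H.relIndex (E ⊓ U) * E.relIndex (traj φ E (k * (n + 1))) := by
    set J := traj (φ ^ k) F n
    have hEJ : E.relIndex J ≤ E.relIndex (traj φ E (k * (n + 1))) :=
      AddSubgroup.relIndex_le_of_le_right (hTE n) (hEi.relIndex_traj_ne_zero _)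
    have hEJ0 : E.relIndex J ≠ 0 := fun h0 =>
      hEi.relIndex_traj_ne_zero _ (AddSubgroup.relIndex_eq_zero_of_le_right (hTE n) h0)
    have hEUJ : E ⊓ J ≤ E ⊓ U := inf_le_inf_left E (hTU n)
    have hHJ : H.relIndex (E ⊓ J) ≤ H.relIndex (E ⊓ U) :=
      AddSubgroup.relIndex_le_of_le_right hEUJ hC
    have hHJ0 : H.relIndex (E ⊓ J) ≠ 0 := fun h0 =>
      hC (AddSubgroup.relIndex_eq_zero_of_le_right hEUJ h0)
    have hmul := AddSubgroup.relIndex_inf_mul_relIndex H E J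
    have hne : (H ⊓ E).relIndex J ≠ 0 := hmul ▸ mul_ne_zero hHJ0 hEJ0
    have hJ : H.relIndex J ≤ (H ⊓ E).relIndex J :=
      AddSubgroup.relIndex_le_of_le_left inf_le_left hne
    have hJ0 : H.relIndex J ≠ 0 := fun h0 =>
      hne (AddSubgroup.relIndex_eq_zero_of_le_left inf_le_left h0)
    calc H.relIndex (traj (φ ^ k) H (n + 1)) ≤ H.relIndex (H ⊔ J) :=
          AddSubgroup.relIndex_le_of_le_right (traj_succ_le_sup hleF n)
            (by rwa [AddSubgroup.relIndex_sup_left])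
      _ = H.relIndex J := AddSubgroup.relIndex_sup_left _ _
      _ ≤ H.relIndex (E ⊓ J) * E.relIndex J := hJ.trans hmul.ge
      _ ≤ _ := Nat.mul_le_mul hHJ hEJ
  have hlim := (tendsto_entFun_mul hk hEi).add
    ((tendsto_const_nhds (x := Real.log (H.relIndex (E ⊓ U)))).div_atTop
      tendsto_natCast_atTop_atTop)
  rw [add_zero] at hlim
  refine le_of_tendsto_of_tendsto h.tendsto_entFun hlim
    ((eventually_gt_atTop 0).mono fun n hn => ?_)
  have hn' : (0 : ℝ) < n := by positivity
  have hk' : (k : ℝ) ≠ 0 := by positivity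
  have hlog : Real.log (H.relIndex (traj (φ ^ k) H n)) ≤
      Real.log (H.relIndex (E ⊓ U)) + Real.log (E.relIndex (traj φ E (k * n))) := by
    rw [← Real.log_mul (mod_cast hC) (mod_cast hEi.relIndex_traj_ne_zero _)]
    obtain ⟨m, rfl⟩ := Nat.exists_eq_succ_of_ne_zero hn.ne'
    exact Real.log_le_log (zero_lt_one.trans_le (h.one_le_relIndex_traj _)) (mod_cast hle m)
  beta_reduce
  rw [entFun_eq, entFun_eq]
  push_cast
  calc _ ≤ _ / (n : ℝ) := div_le_div_of_nonneg_right hlog hn'.le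
    _ = _ := by field_simp; ring

theorem intrinsicEnt_pow_le (hφ : ∀ x : G, ∃ p : ℤ[X], p ≠ 0 ∧ aeval φ p x = 0) {k : ℕ}
    (hk : 0 < k) : intrinsicEnt (φ ^ k) ≤ k * intrinsicEnt φ := by
  refine iSup₂_le fun H h => ?_
  obtain ⟨E, hE, hle⟩ := exists_entWrt_pow_le hφ hk h
  refine (ENNReal.ofReal_le_ofReal hle).trans ?_
  rw [ENNReal.ofReal_mul k.cast_nonneg, ENNReal.ofReal_natCast]
  exact mul_le_mul_right hE.le_intrinsicEnt _

end Algebraic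

section Transcendental

open Polynomial

/-- The integer polynomials whose coefficients of degree at least `n` are divisible by `m`. -/
def polyDvdFrom (m n : ℕ) : AddSubgroup ℤ[X] where
  carrier := {p | ∀ i, n ≤ i → (m : ℤ) ∣ p.coeff i}
  zero_mem' := by simp
  add_mem' hp hq i hi := by
    rw [coeff_add]
    exact dvd_add (hp i hi) (hq i hi)
  neg_mem' hp i hi := by
    rw [coeff_neg]
    exact (dvd_neg).2 (hp i hi)

theorem polyDvdFrom_mono (m : ℕ) : Monotone (polyDvdFrom m) :=
  fun _ _ h _ hp i hi => hp i (h.trans hi)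

theorem relIndex_polyDvdFrom_succ (m n : ℕ) :
    (polyDvdFrom m n).relIndex (polyDvdFrom m (n + 1)) = m := by
  let χ : ℤ[X] →+ ZMod m :=
    (Int.castAddHom (ZMod m)).comp (lcoeff ℤ n).toAddMonoidHom
  have hχ (p : ℤ[X]) : χ p = (p.coeff n : ZMod m) := rfl
  have hker : polyDvdFrom m n = χ.ker ⊓ polyDvdFrom m (n + 1) := by
    ext p
    rw [AddSubgroup.mem_inf, AddMonoidHom.mem_ker, hχ, ZMod.intCast_zmod_eq_zero_iff_dvd]
    refine ⟨fun hp => ⟨hp n le_rfl, polyDvdFrom_mono m n.le_succ hp⟩, fun hp i hi => ?_⟩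
    rcases hi.eq_or_lt with rfl | hlt
    · exact hp.1
    · exact hp.2 i hlt
  have hmap : (polyDvdFrom m (n + 1)).map χ = ⊤ := by
    refine (AddSubgroup.eq_top_iff' _).2 fun z => ?_
    obtain ⟨a, rfl⟩ := ZMod.intCast_surjective z
    refine ⟨monomial n a, fun i hi => ?_, by rw [hχ, coeff_monomial_same]⟩
    rw [coeff_monomial_of_ne _ (by omega)]
    exact dvd_zero _
  rw [hker, AddSubgroup.inf_relIndex_right, AddSubgroup.relIndex_ker, hmap,
    Nat.card_congr AddSubgroup.topEquiv.toEquiv, Nat.card_zmod]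

theorem relIndex_polyDvdFrom (m n : ℕ) :
    (polyDvdFrom m 1).relIndex (polyDvdFrom m (n + 1)) = m ^ n := by
  induction n with
  | zero => rw [AddSubgroup.relIndex_self, pow_zero]
  | succ n ih =>
    rw [← AddSubgroup.relIndex_mul_relIndex _ (polyDvdFrom m (n + 1)) _
      (polyDvdFrom_mono m (by omega)) (polyDvdFrom_mono m (by omega)), ih,
      relIndex_polyDvdFrom_succ, pow_succ]

theorem polyDvdFrom_sup_map (m n : ℕ) :
    polyDvdFrom m 1 ⊔ (polyDvdFrom m (n + 1)).map (AddMonoidHom.mulLeft X) =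
      polyDvdFrom m (n + 2) := by
  refine le_antisymm (sup_le (polyDvdFrom_mono m (by omega)) ?_) fun p hp => ?_
  · rintro _ ⟨p, hp, rfl⟩ i hi
    obtain ⟨j, rfl⟩ := Nat.exists_eq_succ_of_ne_zero (show i ≠ 0 by omega)
    rw [AddMonoidHom.coe_mulLeft, coeff_X_mul]
    exact hp j (by omega)
  · have hC : C (p.coeff 0) ∈ polyDvdFrom m 1 := fun i hi => by
      rw [coeff_C_of_ne_zero (by omega)]
      exact dvd_zero _
    have hX : AddMonoidHom.mulLeft X p.divX ∈
        (polyDvdFrom m (n + 1)).map (AddMonoidHom.mulLeft X) :=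
      AddSubgroup.mem_map_of_mem _ fun i hi => by
        rw [coeff_divX]
        exact hp _ (by omega)
    have h := AddSubgroup.add_mem_sup hC hX
    rwa [AddMonoidHom.coe_mulLeft, add_comm (C _), X_mul_divX_add] at h

variable [AddCommGroup G] {φ : AddMonoid.End G}

theorem log_le_intrinsicEnt {x : G} (hx : ∀ p : ℤ[X], aeval φ p x = 0 → p = 0) {m : ℕ}
    (hm : m ≠ 0) : ENNReal.ofReal (Real.log m) ≤ intrinsicEnt φ := by
  let e : ℤ[X] →+ G := (AddMonoidHom.eval x).comp (aeval φ).toAddMonoidHom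
  have he (p : ℤ[X]) : e p = aeval φ p x := rfl
  have hinj : Function.Injective e := (injective_iff_map_eq_zero e).2 hx
  have hcomm (A : AddSubgroup ℤ[X]) :
      (A.map e).map φ = (A.map (AddMonoidHom.mulLeft X)).map e := by
    have h : AddMonoidHom.comp φ e = e.comp (AddMonoidHom.mulLeft X) := by
      refine AddMonoidHom.ext fun p => ?_
      change φ (aeval φ p x) = aeval φ (X * p) x
      rw [map_mul, aeval_X, AddMonoid.End.coe_mul, Function.comp_apply]
    rw [AddSubgroup.map_map A, ← h]
    exact AddSubgroup.map_map A _ _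
  set H := (polyDvdFrom m 1).map e
  have htraj (n : ℕ) : traj φ H (n + 1) = (polyDvdFrom m (n + 1)).map e := by
    induction n with
    | zero => exact traj_one φ H
    | succ n ih => rw [traj_succ, ih, hcomm, ← AddSubgroup.map_sup, polyDvdFrom_sup_map]
  have hidx (n : ℕ) : H.relIndex (traj φ H (n + 1)) = m ^ n := by
    rw [htraj, AddSubgroup.relIndex_map_map_of_injective _ _ hinj, relIndex_polyDvdFrom]
  have hinert : IsInert φ H := by
    have h := hidx 1
    rw [traj_succ, traj_one, AddSubgroup.relIndex_sup_left] at h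
    rw [isInert_iff, h]
    exact pow_ne_zero 1 hm
  have hent : entWrt φ H = Real.log m := by
    refine tendsto_nhds_unique ((tendsto_add_atTop_iff_nat 1).2 hinert.tendsto_entFun) ?_
    have hlim := (tendsto_natCast_div_add_atTop (1 : ℝ)).mul_const (Real.log m)
    rw [one_mul] at hlim
    refine hlim.congr fun n => ?_
    rw [entFun_eq, hidx, Nat.cast_pow, Real.log_pow]
    push_cast
    ring
  rw [← hent]
  exact hinert.le_intrinsicEnt

theorem intrinsicEnt_eq_top {x : G} (hx : ∀ p : ℤ[X], aeval φ p x = 0 → p = 0) :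
    intrinsicEnt φ = ∞ := by
  have hlim : Tendsto (fun m : ℕ => ENNReal.ofReal (Real.log m)) atTop (𝓝 ∞) :=
    ENNReal.tendsto_ofReal_nhds_top.2
      (Real.tendsto_log_atTop.comp tendsto_natCast_atTop_atTop)
  exact top_le_iff.1 (le_of_tendsto hlim
    ((eventually_ne_atTop 0).mono fun m hm => log_le_intrinsicEnt hx hm))

end Transcendental

/-- **Logarithmic Law** for the intrinsic algebraic entropy:
`ent̃(φ^k) = k · ent̃(φ)` in `[0,∞]`. -/
theorem logarithmic_law [AddCommGroup G] (φ : AddMonoid.End G) (k : ℕ) (hk : 0 < k) :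
    intrinsicEnt (φ ^ k) = (k : ℝ≥0∞) * intrinsicEnt φ := by
  refine le_antisymm ?_ (mul_intrinsicEnt_le φ hk)
  by_cases hφ : ∀ x : G, ∃ p : Polynomial ℤ, p ≠ 0 ∧ Polynomial.aeval φ p x = 0
  · exact intrinsicEnt_pow_le hφ hk
  · push Not at hφ
    obtain ⟨x, hx⟩ := hφ
    rw [intrinsicEnt_eq_top fun p hp => by_contra fun h => hx p h hp,
      ENNReal.mul_top (Nat.cast_ne_zero.2 hk.ne')]
    exact le_top
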